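/- arXiv:1709.06924 — 2 statements merged into one kernel-verified Lean document; each statement's English description precedes it below -/
import Mathlib

section
/- Let Ω ⊆ ℝ^N be measurable, ρ : ℝ^N → ℝ nonnegative measurable with ∫_Ω (1 + ‖y‖²) ρ(y) dy finite, and let z_1, …, z_K ∈ ℝ^N. Suppose W_1, …, W_K are pairwise disjoint measurable sets with union Ω such that each W_i is contained in the closed Voronoi cell {x ∈ Ω : ‖x − z_i‖ ≤ ‖x − z_j‖ for all j}, and suppose each mass m_i = ∫_{W_i} ρ(y) dy is strictly positive. Define the Lloyd update T_i = m_i⁻¹ ∫_{W_i} y ρ(y) dy. Then the CVT energy does not increase: ∫_Ω (min_{1≤i≤K} ‖y − T_i‖²) ρ(y) dy ≤ ∫_Ω (min_{1≤i≤K} ‖y − z_i‖²) ρ(y) dy. -/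
open MeasureTheory

theorem lloyd_aux_int {N : ℕ} {S : Set (EuclideanSpace ℝ (Fin N))}
    {ρ : EuclideanSpace ℝ (Fin N) → ℝ} (hρmeas : Measurable ρ) (hρnn : ∀ y, 0 ≤ ρ y)
    (hint : IntegrableOn (fun y => (1 + ‖y‖ ^ 2) * ρ y) S) (c : EuclideanSpace ℝ (Fin N)) :
    IntegrableOn (fun y => ‖y - c‖ ^ 2 * ρ y) S := by
  refine Integrable.mono' (hint.const_mul (2 * (1 + ‖c‖ ^ 2))) ?_ (ae_of_all _ fun y => ?_)
  · exact Measurable.aestronglyMeasurable (by fun_prop)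
  · rw [Real.norm_of_nonneg (mul_nonneg (by positivity) (hρnn y)), ← mul_assoc]
    refine mul_le_mul_of_nonneg_right ?_ (hρnn y)
    have h1 := norm_sub_le y c
    have h2 : ‖y - c‖ ^ 2 ≤ (‖y‖ + ‖c‖) ^ 2 := by gcongr
    nlinarith [sq_nonneg (‖y‖ - ‖c‖), mul_nonneg (sq_nonneg ‖y‖) (sq_nonneg ‖c‖)]

theorem lloyd_aux_cell {N : ℕ} {S : Set (EuclideanSpace ℝ (Fin N))}
    {ρ : EuclideanSpace ℝ (Fin N) → ℝ} (hρmeas : Measurable ρ) (hρnn : ∀ y, 0 ≤ ρ y)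
    (hint : IntegrableOn (fun y => (1 + ‖y‖ ^ 2) * ρ y) S) (z T : EuclideanSpace ℝ (Fin N))
    (hm : 0 < ∫ y in S, ρ y) (hT : T = (∫ y in S, ρ y)⁻¹ • ∫ y in S, ρ y • y) :
    ∫ y in S, ‖y - T‖ ^ 2 * ρ y ≤ ∫ y in S, ‖y - z‖ ^ 2 * ρ y := by
  have hρ : IntegrableOn ρ S := by
    refine Integrable.mono' hint hρmeas.aestronglyMeasurable (ae_of_all _ fun y => ?_)
    rw [Real.norm_of_nonneg (hρnn y)]
    nlinarith [mul_nonneg (sq_nonneg ‖y‖) (hρnn y)]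
  have hy : IntegrableOn (fun y => ρ y • y) S := by
    refine Integrable.mono' hint (Measurable.aestronglyMeasurable (by fun_prop))
      (ae_of_all _ fun y => ?_)
    rw [norm_smul, Real.norm_of_nonneg (hρnn y), mul_comm]
    refine mul_le_mul_of_nonneg_right ?_ (hρnn y)
    nlinarith [sq_nonneg (‖y‖ - 1), norm_nonneg y]
  have hd : IntegrableOn (fun y => ρ y • y - ρ y • T) S := hy.sub (hρ.smul_const T)
  have h0 : ∫ y in S, (ρ y • y - ρ y • T) = 0 := by
    rw [integral_sub hy (hρ.smul_const T), integral_smul_const]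
    rw [hT]
    rw [smul_inv_smul₀ hm.ne', sub_self]
  have h1 : ∫ y in S, inner ℝ (T - z) (ρ y • y - ρ y • T) = 0 := by
    rw [integral_inner hd, h0, inner_zero_right]
  have hin : IntegrableOn (fun y => inner ℝ (T - z) (ρ y • y - ρ y • T)) S :=
    hd.const_inner (T - z)
  have hTi := lloyd_aux_int hρmeas hρnn hint T
  have hTin := Integrable.add hTi (hin.const_mul 2)
  calc ∫ y in S, ‖y - T‖ ^ 2 * ρ y
      = ∫ y in S, (‖y - T‖ ^ 2 * ρ y + 2 * inner ℝ (T - z) (ρ y • y - ρ y • T)) := by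
        rw [integral_add hTi (hin.const_mul 2), integral_const_mul, h1]; simp
    _ ≤ _ := by
        refine integral_mono hTin (lloyd_aux_int hρmeas hρnn hint z) fun y => ?_
        have e : y - z = (T - z) + (y - T) := by abel
        have e2 : ‖y - z‖ ^ 2 = ‖T - z‖ ^ 2 + 2 * inner ℝ (T - z) (y - T) + ‖y - T‖ ^ 2 := by
          rw [e, norm_add_sq_real]
        simp only [Pi.add_apply]
        rw [← smul_sub, inner_smul_right, e2]
        nlinarith [mul_nonneg (sq_nonneg ‖T - z‖) (hρnn y)]

/-- The Lloyd update (moving each generator to the mass centroid of its Voronoi cell)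
does not increase the CVT energy. -/
theorem lloyd_update_energy_nonincreasing {N K : ℕ}
    (Ω : Set (EuclideanSpace ℝ (Fin N))) (hΩ : MeasurableSet Ω)
    (ρ : EuclideanSpace ℝ (Fin N) → ℝ) (hρmeas : Measurable ρ) (hρnn : ∀ y, 0 ≤ ρ y)
    (hint : IntegrableOn (fun y => (1 + ‖y‖ ^ 2) * ρ y) Ω)
    (z : Fin K → EuclideanSpace ℝ (Fin N))
    (W : Fin K → Set (EuclideanSpace ℝ (Fin N)))
    (hWmeas : ∀ i, MeasurableSet (W i))
    (hWdisj : ∀ i j, i ≠ j → Disjoint (W i) (W j))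
    (hWunion : (⋃ i, W i) = Ω)
    (hWsub : ∀ i, W i ⊆ {x ∈ Ω | ∀ j : Fin K, ‖x - z i‖ ≤ ‖x - z j‖})
    (m : Fin K → ℝ) (hm : ∀ i, m i = ∫ y in W i, ρ y) (hmpos : ∀ i, 0 < m i)
    (T : Fin K → EuclideanSpace ℝ (Fin N))
    (hT : ∀ i, T i = (m i)⁻¹ • ∫ y in W i, ρ y • y) :
    ∫ y in Ω, (⨅ i : Fin K, ‖y - T i‖ ^ 2) * ρ y
      ≤ ∫ y in Ω, (⨅ i : Fin K, ‖y - z i‖ ^ 2) * ρ y := by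
  have hbdd : ∀ (c : Fin K → EuclideanSpace ℝ (Fin N)) (y : EuclideanSpace ℝ (Fin N)),
      BddBelow (Set.range fun i => ‖y - c i‖ ^ 2) := fun c y => (Set.finite_range _).bddBelow
  have hWint : ∀ i, IntegrableOn (fun y => (1 + ‖y‖ ^ 2) * ρ y) (W i) := fun i =>
    hint.mono_set (hWunion ▸ Set.subset_iUnion W i)
  have hinf : ∀ (c : Fin K → EuclideanSpace ℝ (Fin N)) (i : Fin K),
      IntegrableOn (fun y => (⨅ i : Fin K, ‖y - c i‖ ^ 2) * ρ y) (W i) := by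
    intro c i
    refine Integrable.mono' (lloyd_aux_int hρmeas hρnn (hWint i) (c i)) ?_
      (ae_of_all _ fun y => ?_)
    · refine Measurable.aestronglyMeasurable (Measurable.mul (Measurable.iInf fun j => ?_) hρmeas)
      fun_prop
    · rw [Real.norm_of_nonneg (mul_nonneg (Real.iInf_nonneg fun _ => by positivity) (hρnn y))]
      exact mul_le_mul_of_nonneg_right (ciInf_le (hbdd c y) i) (hρnn y)
  have hd : Pairwise (Function.onFun Disjoint W) := fun i j h => hWdisj i j h
  rw [← hWunion, integral_iUnion_fintype hWmeas hd (hinf T),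
    integral_iUnion_fintype hWmeas hd (hinf z)]
  refine Finset.sum_le_sum fun i _ => ?_
  have hz : ∫ y in W i, (⨅ i : Fin K, ‖y - z i‖ ^ 2) * ρ y = ∫ y in W i, ‖y - z i‖ ^ 2 * ρ y := by
    refine setIntegral_congr_fun (hWmeas i) fun y hy => ?_
    have : Nonempty (Fin K) := ⟨i⟩
    have h : (⨅ i : Fin K, ‖y - z i‖ ^ 2) = ‖y - z i‖ ^ 2 :=
      le_antisymm (ciInf_le (hbdd z y) i) (le_ciInf fun j => by
        have := (hWsub i hy).2 j
        gcongr)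
    simp only [h]
  rw [hz]
  refine le_trans (integral_mono (hinf T i) (lloyd_aux_int hρmeas hρnn (hWint i) (T i))
    fun y => mul_le_mul_of_nonneg_right (ciInf_le (hbdd T y) i) (hρnn y)) ?_
  exact lloyd_aux_cell hρmeas hρnn (hWint i) (z i) (T i) (hm i ▸ hmpos i) (hm i ▸ hT i)
end

section
/- Let Ω ⊆ ℝ^N be a bounded measurable set, ρ : ℝ^N → ℝ nonnegative measurable with ∫_Ω ρ(y) dy finite, and let z_1, …, z_K be pairwise distinct points of ℝ^N. Fix an index i, let V_i = {x ∈ Ω : ‖x − z_i‖ < ‖x − z_j‖ for all j ≠ i}, m_i = ∫_{V_i} ρ(y) dy and b_i = ∫_{V_i} y ρ(y) dy. Then the function w ↦ ∫_Ω min( ‖y − w‖², min_{j ≠ i} ‖y − z_j‖² ) ρ(y) dy is differentiable at w = z_i with gradient 2 m_i z_i − 2 b_i. -/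
open MeasureTheory

/-- Gradient of the CVT energy with respect to a single generator: the function
`w ↦ ∫_Ω min(‖y − w‖², min_{j ≠ i} ‖y − z j‖²) ρ(y) dy` is differentiable at `w = z i`
with gradient `2 m_i z_i − 2 b_i`, where `m_i` and `b_i` are the mass and first moment
of the (open) Voronoi region `V i`. -/
theorem cvt_energy_gradient_at_generator {N K : ℕ} (hK : 2 ≤ K)
    (Ω : Set (EuclideanSpace ℝ (Fin N))) (hΩ : MeasurableSet Ω)
    (hΩbd : Bornology.IsBounded Ω)
    (ρ : EuclideanSpace ℝ (Fin N) → ℝ) (hρmeas : Measurable ρ) (hρnn : ∀ y, 0 ≤ ρ y)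
    (hint : IntegrableOn ρ Ω)
    (z : Fin K → EuclideanSpace ℝ (Fin N)) (hz : Function.Injective z) (i : Fin K)
    (Vi : Set (EuclideanSpace ℝ (Fin N)))
    (hVi : Vi = {x ∈ Ω | ∀ j : Fin K, j ≠ i → ‖x - z i‖ < ‖x - z j‖})
    (mi : ℝ) (hmi : mi = ∫ y in Vi, ρ y)
    (bi : EuclideanSpace ℝ (Fin N)) (hbi : bi = ∫ y in Vi, ρ y • y) :
    HasGradientAt
      (fun w : EuclideanSpace ℝ (Fin N) =>
        ∫ y in Ω, min (‖y - w‖ ^ 2) (⨅ j : {j : Fin K // j ≠ i}, ‖y - z j.1‖ ^ 2) * ρ y)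
      ((2 * mi) • z i - (2 : ℝ) • bi) (z i) := by
  obtain ⟨R, hR⟩ := hΩbd.exists_norm_le
  have hne : Nonempty {j : Fin K // j ≠ i} := by
    have : Nontrivial (Fin K) := Fin.nontrivial_iff_two_le.mpr hK
    obtain ⟨j, hj⟩ := exists_ne i
    exact ⟨⟨j, hj⟩⟩
  have hcmeas : Measurable (fun y : EuclideanSpace ℝ (Fin N) =>
      ⨅ j : {j : Fin K // j ≠ i}, ‖y - z j.1‖ ^ 2) := by
    apply Measurable.iInf
    intro j
    fun_prop
  have hcnn : ∀ y : EuclideanSpace ℝ (Fin N),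
      0 ≤ ⨅ j : {j : Fin K // j ≠ i}, ‖y - z j.1‖ ^ 2 := fun y =>
    Real.iInf_nonneg fun j => by positivity
  have hVm : MeasurableSet Vi := by
    rw [hVi]
    have : MeasurableSet {x : EuclideanSpace ℝ (Fin N) |
        ∀ j : Fin K, j ≠ i → ‖x - z i‖ < ‖x - z j‖} := by
      have h2 : {x : EuclideanSpace ℝ (Fin N) |
        ∀ j : Fin K, j ≠ i → ‖x - z i‖ < ‖x - z j‖} =
          ⋂ j : {j : Fin K // j ≠ i}, {x | ‖x - z i‖ < ‖x - z j.1‖} := by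
        ext x; simp
      rw [h2]
      refine MeasurableSet.iInter fun j => ?_
      exact measurableSet_lt (by fun_prop) (by fun_prop)
    exact hΩ.inter this
  have hVsub : Vi ⊆ Ω := by rw [hVi]; exact fun x hx => hx.1
  have hnull : ∀ᵐ y : EuclideanSpace ℝ (Fin N), ∀ j : Fin K, j ≠ i → ‖y - z i‖ ≠ ‖y - z j‖ := by
    rw [ae_all_iff]
    intro j
    by_cases hj : j = i
    · exact Filter.Eventually.of_forall fun y h => absurd hj h
    have h0 := Measure.addHaar_affineSubspace (volume : Measure (EuclideanSpace ℝ (Fin N)))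
      (AffineSubspace.perpBisector (z i) (z j))
      (by rw [Ne, AffineSubspace.perpBisector_eq_top]; exact fun h => hj (hz h).symm)
    have h1 := measure_eq_zero_iff_ae_notMem.mp h0
    filter_upwards [h1] with y hy _ h
    apply hy
    rw [SetLike.mem_coe, AffineSubspace.mem_perpBisector_iff_dist_eq, dist_eq_norm, dist_eq_norm]
    exact h
  have hμ : ∀ᵐ y ∂(volume.restrict Ω), y ∈ Ω := ae_restrict_mem hΩ
  have key := hasFDerivAt_integral_of_dominated_loc_of_lip (𝕜 := ℝ) (μ := volume.restrict Ω)
    (F := fun (w y : EuclideanSpace ℝ (Fin N)) =>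
      min (‖y - w‖ ^ 2) (⨅ j : {j : Fin K // j ≠ i}, ‖y - z j.1‖ ^ 2) * ρ y)
    (F' := Vi.indicator fun y => innerSL ℝ ((2 * ρ y) • (z i - y)))
    (x₀ := z i) (s := Metric.ball (z i) 1)
    (bound := fun y => (2 * (R + ‖z i‖ + 1)) * ρ y)
    (Metric.ball_mem_nhds _ one_pos) ?_ ?_ ?_ ?_ ?_ ?_
  · obtain ⟨hi1, hi2⟩ := key
    rw [hasGradientAt_iff_hasFDerivAt]
    refine hi2.congr_fderiv (Eq.symm ?_)
    have hρV : IntegrableOn ρ Vi := hint.mono_set hVsub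
    have hyV : IntegrableOn (fun y => ρ y • y) Vi := by
      refine Integrable.mono' (hρV.const_mul R) ?_ ?_
      · exact Measurable.aestronglyMeasurable (by fun_prop)
      · filter_upwards [ae_restrict_mem hVm] with y hy
        rw [norm_smul, Real.norm_of_nonneg (hρnn y), mul_comm]
        exact mul_le_mul_of_nonneg_right (hR y (hVsub hy)) (hρnn y)
    refine ContinuousLinearMap.ext fun v => ?_
    rw [ContinuousLinearMap.integral_apply hi1]
    have e1 : ∀ y, (Vi.indicator (fun y => innerSL ℝ ((2 * ρ y) • (z i - y))) y) v
        = Vi.indicator (fun y => inner ℝ v ((2 * ρ y) • (z i - y))) y := by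
      intro y
      by_cases hy : y ∈ Vi
      · simp only [Set.indicator_of_mem hy, innerSL_apply_apply]
        exact real_inner_comm _ _
      · simp [Set.indicator_of_notMem hy]
    simp_rw [e1]
    rw [setIntegral_indicator hVm, Set.inter_eq_self_of_subset_right hVsub]
    have e2 : ∀ y, (2 * ρ y) • (z i - y) = ρ y • ((2:ℝ) • z i) - (2:ℝ) • (ρ y • y) := by
      intro y; module
    have hA : IntegrableOn (fun y => ρ y • ((2:ℝ) • z i)) Vi := Integrable.smul_const hρV _
    have hB : IntegrableOn (fun y => (2:ℝ) • (ρ y • y)) Vi := by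
      exact Integrable.smul (2:ℝ) hyV
    have hAB : Integrable (fun y => ρ y • ((2:ℝ) • z i) - (2:ℝ) • (ρ y • y))
        (volume.restrict Vi) := Integrable.sub hA hB
    simp_rw [e2]
    rw [integral_inner hAB, integral_sub hA hB, integral_smul_const, integral_smul,
      ← hmi, ← hbi, InnerProductSpace.toDual_apply_apply, real_inner_comm]
    congr 1
    module
  · refine Filter.Eventually.of_forall fun w => Measurable.aestronglyMeasurable ?_
    exact (Measurable.min (by fun_prop) hcmeas).mul hρmeas
  · refine Integrable.mono' (hint.const_mul ((R + ‖z i‖) ^ 2)) ?_ ?_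
    · exact ((Measurable.min (by fun_prop) hcmeas).mul hρmeas).aestronglyMeasurable
    · filter_upwards [hμ] with y hy
      rw [norm_mul, Real.norm_of_nonneg (hρnn y),
        Real.norm_of_nonneg (le_min (by positivity) (hcnn y))]
      refine mul_le_mul_of_nonneg_right ((min_le_left _ _).trans ?_) (hρnn y)
      refine pow_le_pow_left₀ (norm_nonneg _) ?_ 2
      exact (norm_sub_le _ _).trans (by linarith [hR y hy])
  · refine AEStronglyMeasurable.indicator ?_ hVm
    refine (innerSL ℝ).continuous.comp_aestronglyMeasurable ?_
    exact Measurable.aestronglyMeasurable (by fun_prop)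
  · filter_upwards [hμ] with y hy
    have hR0 : 0 ≤ R := (norm_nonneg y).trans (hR y hy)
    refine LipschitzOnWith.of_dist_le_mul fun w hw w' hw' => ?_
    have hb : 0 ≤ (2 * (R + ‖z i‖ + 1)) * ρ y := mul_nonneg (by positivity) (hρnn y)
    rw [Real.coe_nnabs, abs_of_nonneg hb, Real.dist_eq, ← sub_mul, abs_mul,
      abs_of_nonneg (hρnn y)]
    have hn : ∀ w ∈ Metric.ball (z i) 1, ‖y - w‖ ≤ R + ‖z i‖ + 1 := by
      intro w hw
      rw [mem_ball_iff_norm] at hw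
      have : y - w = y - z i - (w - z i) := by abel
      rw [this]
      have h1 := norm_sub_le (y - z i) (w - z i)
      have h2 := norm_sub_le y (z i)
      linarith [hR y hy]
    have h1 := abs_min_sub_min_le_max (‖y - w‖ ^ 2)
      (⨅ j : {j : Fin K // j ≠ i}, ‖y - z j.1‖ ^ 2) (‖y - w'‖ ^ 2)
      (⨅ j : {j : Fin K // j ≠ i}, ‖y - z j.1‖ ^ 2)
    rw [sub_self, abs_zero, max_eq_left (abs_nonneg _)] at h1
    have h3 : |‖y - w‖ - ‖y - w'‖| ≤ dist w w' := by
      refine (abs_norm_sub_norm_le _ _).trans ?_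
      rw [dist_comm, dist_eq_norm]
      apply le_of_eq
      congr 1
      abel
    have h4 : |‖y - w‖ ^ 2 - ‖y - w'‖ ^ 2| ≤ 2 * (R + ‖z i‖ + 1) * dist w w' := by
      rw [sq_sub_sq, abs_mul]
      refine mul_le_mul ?_ h3 (abs_nonneg _) (by positivity)
      rw [abs_of_nonneg (by positivity)]
      linarith [hn w hw, hn w' hw']
    calc _ ≤ (2 * (R + ‖z i‖ + 1) * dist w w') * ρ y :=
          mul_le_mul_of_nonneg_right (h1.trans h4) (hρnn y)
      _ = _ := by ring
  · exact hint.const_mul _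
  · filter_upwards [hμ, ae_restrict_of_ae hnull] with y hy hy2
    have hcont : Continuous fun w : EuclideanSpace ℝ (Fin N) => ‖y - w‖ ^ 2 := by fun_prop
    obtain ⟨j0, hj0⟩ := exists_eq_ciInf_of_finite
      (f := fun j : {j : Fin K // j ≠ i} => ‖y - z j.1‖ ^ 2)
    by_cases hyV : y ∈ Vi
    · rw [Set.indicator_of_mem hyV]
      rw [hVi] at hyV
      have hlt : ‖y - z i‖ ^ 2 < ⨅ j : {j : Fin K // j ≠ i}, ‖y - z j.1‖ ^ 2 := by
        rw [← hj0]
        exact pow_lt_pow_left₀ (hyV.2 j0.1 j0.2) (norm_nonneg _) two_ne_zero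
      have hev := hcont.continuousAt.eventually_lt_const hlt
      have hd : HasFDerivAt (fun w : EuclideanSpace ℝ (Fin N) => ‖y - w‖ ^ 2 * ρ y)
          (innerSL ℝ ((2 * ρ y) • (z i - y))) (z i) := by
        have h := (((hasFDerivAt_id (𝕜 := ℝ) (z i)).const_sub y).norm_sq).mul_const (ρ y)
        refine h.congr_fderiv (ContinuousLinearMap.ext fun v => ?_)
        simp [inner_smul_left, inner_sub_left]
        ring
      refine hd.congr_of_eventuallyEq ?_
      filter_upwards [hev] with w hw
      simp only [min_eq_left hw.le]
    · rw [Set.indicator_of_notMem hyV]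
      have hex : ∃ j : Fin K, j ≠ i ∧ ‖y - z j‖ < ‖y - z i‖ := by
        by_contra hcon
        push Not at hcon
        apply hyV
        rw [hVi]
        exact ⟨hy, fun j hj => lt_of_le_of_ne (hcon j hj) (hy2 j hj)⟩
      obtain ⟨j, hj, hlt⟩ := hex
      have hlt2 : (⨅ j : {j : Fin K // j ≠ i}, ‖y - z j.1‖ ^ 2) < ‖y - z i‖ ^ 2 :=
        (ciInf_le (f := fun j : {j : Fin K // j ≠ i} => ‖y - z j.1‖ ^ 2)
          (Set.finite_range _).bddBelow ⟨j, hj⟩).trans_lt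
          (pow_lt_pow_left₀ hlt (norm_nonneg _) two_ne_zero)
      have hev := hcont.continuousAt.eventually_const_lt hlt2
      refine (hasFDerivAt_const ((⨅ j : {j : Fin K // j ≠ i}, ‖y - z j.1‖ ^ 2) * ρ y)
        (z i)).congr_of_eventuallyEq ?_
      filter_upwards [hev] with w hw
      simp only [min_eq_right hw.le]
end
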